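/- arXiv:2506.14216 — 2 statements merged into one kernel-verified Lean document; each statement's English description precedes it below -/
import Mathlib

section
/- Let (S,·,∗) be an associative pentagon algebra such that (S,∗) is a band (every element is ∗-idempotent). Then x∗y = y for all x,y ∈ S, i.e., (S,∗) is a right-zero semigroup. -/
theorem stmt4 {S : Type*} (m s : S → S → S)
    (hm : ∀ a b c : S, m (m a b) c = m a (m b c))
    (hs : ∀ a b c : S, s (s a b) c = s a (s b c))
    (hI : ∀ a b c : S, m (s a b) (s (m a b) c) = s a (m b c))
    (hII : ∀ a b c : S, s (s a b) (s (m a b) c) = s b c)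
    (hband : ∀ x : S, s x x = x) :
    ∀ x y : S, s x y = y := by
  intro x y
  have h1 : s x (s y y) = s y y := by
    have h2 := hII x y y
    calc s x (s y y) = s x (s (s x y) (s (m x y) y)) := by rw [h2]
      _ = s (s (s x x) y) (s (m x y) y) := by simp only [hs]
      _ = s y y := by rw [hband x, h2]
  rwa [hband y] at h1
end

section
/- Let (S,·,∗) be an associative pentagon algebra such that (S,·) has a right identity e (x·e = x for all x). Then (S,·,∗) is left-trivially distributive: (x·y)∗z = x∗z for all x,y,z ∈ S. -/
theorem stmt16 {S : Type*} (m s : S → S → S) (e : S)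
    (hm : ∀ a b c : S, m (m a b) c = m a (m b c))
    (hs : ∀ a b c : S, s (s a b) c = s a (s b c))
    (hI : ∀ a b c : S, m (s a b) (s (m a b) c) = s a (m b c))
    (hII : ∀ a b c : S, s (s a b) (s (m a b) c) = s b c)
    (he : ∀ x : S, m x e = x) :
    ∀ x y z : S, s (m x y) z = s x z := by
  have f1 : ∀ x z, s x (s e (s x z)) = s e z := fun x z => by
    have h := hII x e z
    rwa [he, hs] at h
  have f2 : ∀ x z, s x (s e (s e (s x (s e z)))) = s e z := fun x z => by
    have h := f1 (s x e) z
    rwa [hs, hs] at h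
  have comm : ∀ x z, s x (s e z) = s e (s x z) := fun x z => by
    have h := f2 x (s x z)
    rwa [f1 x z, f1 e z] at h
  have idl : ∀ y z, s e (s e (s y z)) = s y z := fun y z => by
    have h := hII e y z
    rw [hs] at h
    rw [← h, f1 e]
  have sq : ∀ x z, s x (s x z) = s e (s e z) := fun x z => by
    rw [← idl x (s x z), ← comm x (s x z), f1 x z]
  intro x y z
  have h := hII x y z
  rw [hs] at h
  have h1 : s y (s (m x y) z) = s x (s y z) := by
    rw [← h, sq x, idl]
  have h2 : s (m x y) z = s y (s x (s y z)) := by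
    rw [← h1, sq y, idl]
  have h3 := sq (s x y) z
  rw [hs, hs] at h3
  rw [h2, ← idl y (s x (s y z)), ← sq x, h3, comm, comm, idl]
end
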